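/- Let s be a bounded analytic function on the unit disk with |s(z)| ≤ 1, and suppose s has a pseudocontinuation of bounded type across an arc γ of the unit circle but is not unimodular a.e. on γ. Then the function h(z) = 1 − g(z)s(z), where g(z) = conj(s̃(1/conj(z))) and s̃ is the pseudocontinuation, is a not-identically-zero function of bounded type on the disk, and consequently ∫_γ log(1 − |s(t)|²) dm(t) > −∞. -/

import Mathlib

open MeasureTheory Filter Complex Set Matrix

noncomputable section

/-- The open unit disk. -/
def unitDisk : Set ℂ := {z : ℂ | ‖z‖ < 1}

/-- The exterior of the closed unit disk. -/
def extDisk : Set ℂ := {z : ℂ | 1 < ‖z‖}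

/-- Point on the unit circle with angle `θ`. -/
def circlePt (θ : ℝ) : ℂ := Complex.exp (θ * Complex.I)

/-- One full period of angles, parametrizing the circle 𝕋. -/
def circleSet : Set ℝ := Set.Ioc 0 (2 * Real.pi)

/-- `RadLim f θ w` : the radial (nontangential) boundary value of `f` (analytic in the
disk) at the boundary point `circlePt θ` exists and equals `w`. -/
def RadLim (f : ℂ → ℂ) (θ : ℝ) (w : ℂ) : Prop :=
  Filter.Tendsto (fun r : ℝ => f ((r : ℂ) * circlePt θ))
    (nhdsWithin 1 (Set.Iio 1)) (nhds w)

/-- `RadLimExt f θ w` : the radial boundary value of `f` (analytic in the exterior disk)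
at the boundary point `circlePt θ`, taken from outside. -/
def RadLimExt (f : ℂ → ℂ) (θ : ℝ) (w : ℂ) : Prop :=
  Filter.Tendsto (fun r : ℝ => f ((r : ℂ) * circlePt θ))
    (nhdsWithin 1 (Set.Ioi 1)) (nhds w)

/-- A Schur function: analytic on the unit disk and bounded by 1 in modulus. -/
def SchurFn (f : ℂ → ℂ) : Prop :=
  DifferentiableOn ℂ f unitDisk ∧ ∀ z ∈ unitDisk, ‖f z‖ ≤ 1

/-- The Nevanlinna class on a domain `Ω` : quotients of two bounded (contractive)
analytic functions, with not-identically-zero denominator. -/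
def NevOn (Ω : Set ℂ) (f : ℂ → ℂ) : Prop :=
  ∃ f₁ f₂ : ℂ → ℂ, DifferentiableOn ℂ f₁ Ω ∧ DifferentiableOn ℂ f₂ Ω ∧
    (∀ z ∈ Ω, ‖f₁ z‖ ≤ 1) ∧ (∀ z ∈ Ω, ‖f₂ z‖ ≤ 1) ∧
    (∃ z ∈ Ω, f₂ z ≠ 0) ∧ (∀ z ∈ Ω, f₂ z ≠ 0 → f z = f₁ z / f₂ z)

/-- An arc of the unit circle, described by its set of angles (one full period is
`Set.Ioo 0 (2π)` up to a null set, so the case γ = 𝕋 is not excluded). -/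
def IsArc (γ : Set ℝ) : Prop :=
  ∃ a b : ℝ, 0 ≤ a ∧ a < b ∧ b ≤ 2 * Real.pi ∧ γ = Set.Ioo a b

/-- `f` admits a pseudocontinuation of bounded type across the arc with angle set `γ` :
there is a Nevanlinna function on the exterior disk whose boundary values agree with
those of `f` a.e. on `γ`. -/
def PCArc (f : ℂ → ℂ) (γ : Set ℝ) : Prop :=
  ∃ ft : ℂ → ℂ, NevOn extDisk ft ∧
    ∀ᵐ θ ∂(volume.restrict γ), ∃ w : ℂ, RadLim f θ w ∧ RadLimExt ft θ w

/-- The boundary values of `f` exist and are unimodular a.e. on `γ`. -/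
def UnimodularAEOn (f : ℂ → ℂ) (γ : Set ℝ) : Prop :=
  ∀ᵐ θ ∂(volume.restrict γ), ∃ w : ℂ, RadLim f θ w ∧ ‖w‖ = 1

/-- The boundary values of the 2×2 matrix function `S` exist and are unitary a.e. on `γ`. -/
def UnitaryAEOn (S : ℂ → Matrix (Fin 2) (Fin 2) ℂ) (γ : Set ℝ) : Prop :=
  ∀ᵐ θ ∂(volume.restrict γ), ∃ W : Matrix (Fin 2) (Fin 2) ℂ,
    (∀ i j, RadLim (fun z => S z i j) θ (W i j)) ∧ Wᴴ * W = 1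

/-- An outer function on the unit disk (normalized, with multiplicative constant 1):
`f z = exp (∫_𝕋 (t+z)/(t-z) φ(t) dm(t))` for some real integrable boundary data `φ`,
`m` being normalized Lebesgue measure on 𝕋. -/
def IsOuter (f : ℂ → ℂ) : Prop :=
  ∃ φ : ℝ → ℝ, IntegrableOn φ circleSet ∧
    ∀ z ∈ unitDisk, f z =
      Complex.exp (∫ θ in circleSet,
        ((circlePt θ + z) / (circlePt θ - z)) * (φ θ : ℂ) / (2 * Real.pi))

lemma unitDisk_eq_ball : unitDisk = Metric.ball 0 1 := by
  ext z; simp [unitDisk]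

lemma isOpen_unitDisk : IsOpen unitDisk := unitDisk_eq_ball ▸ Metric.isOpen_ball

lemma isOpen_extDisk : IsOpen extDisk := isOpen_lt continuous_const continuous_norm

lemma isConnected_unitDisk : IsConnected unitDisk :=
  unitDisk_eq_ball ▸ (convex_ball _ _).isConnected (Metric.nonempty_ball.2 one_pos)

lemma norm_mul_circlePt (r θ : ℝ) : ‖(r : ℂ) * circlePt θ‖ = |r| := by
  simp [circlePt, Complex.norm_exp_ofReal_mul_I]

lemma mul_circlePt_mem_unitDisk {r : ℝ} (h0 : 0 < r) (h1 : r < 1) (θ : ℝ) :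
    (r : ℂ) * circlePt θ ∈ unitDisk := by
  rw [unitDisk, mem_ofPred_eq, norm_mul_circlePt, abs_of_pos h0]
  exact h1

@[fun_prop]
lemma continuous_circlePt : Continuous circlePt := by
  unfold circlePt; fun_prop

lemma continuous_comp_mul_circlePt {f : ℂ → ℂ} (hf : DifferentiableOn ℂ f unitDisk)
    {r : ℝ} (h0 : 0 < r) (h1 : r < 1) : Continuous fun θ => f ((r : ℂ) * circlePt θ) :=
  hf.continuousOn.comp_continuous (by fun_prop) (mul_circlePt_mem_unitDisk h0 h1)

/-- The zeros of a nonzero analytic function on the disk are countable. -/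
lemma countable_zeros {f : ℂ → ℂ} (hf : DifferentiableOn ℂ f unitDisk)
    (hne : ∃ z ∈ unitDisk, f z ≠ 0) : (f ⁻¹' {0} ∩ unitDisk).Countable := by
  obtain ⟨z, hz, hfz⟩ := hne
  have h := (hf.analyticOnNhd isOpen_unitDisk).preimage_zero_mem_codiscreteWithin hfz hz
    isConnected_unitDisk
  exact (HereditarilyLindelofSpace.isLindelof _).countable_of_isDiscrete
    (isDiscrete_of_codiscreteWithin (s := f ⁻¹' {0}) h)

/-- A nonzero analytic function on the disk is zero-free on circles with radii tending to `1`. -/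
lemma exists_seq_radii_ne_zero {f : ℂ → ℂ} (hf : DifferentiableOn ℂ f unitDisk)
    (hne : ∃ z ∈ unitDisk, f z ≠ 0) :
    ∃ r : ℕ → ℝ, (∀ n, 1 / 2 < r n ∧ r n < 1) ∧ Tendsto r atTop (nhdsWithin 1 (Iio 1)) ∧
      ∀ n θ, f ((r n : ℂ) * circlePt θ) ≠ 0 := by
  have hd : Dense ((fun z : ℂ => ‖z‖) '' (f ⁻¹' {0} ∩ unitDisk))ᶜ :=
    ((countable_zeros hf hne).image _).dense_compl ℝ
  have hex (n : ℕ) : ∃ x ∈ Ioo (1 - 1 / ((n : ℝ) + 2)) 1,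
      x ∈ ((fun z : ℂ => ‖z‖) '' (f ⁻¹' {0} ∩ unitDisk))ᶜ := by
    have hpos : (0 : ℝ) < 1 / ((n : ℝ) + 2) := by positivity
    obtain ⟨x, hx, hx'⟩ := hd.exists_mem_open isOpen_Ioo (nonempty_Ioo.2 (sub_lt_self 1 hpos))
    exact ⟨x, hx', hx⟩
  choose r hr hr' using hex
  have hhalf (n : ℕ) : 1 / 2 < r n := by
    have : 1 / ((n : ℝ) + 2) ≤ 1 / 2 :=
      one_div_le_one_div_of_le two_pos (by linarith [n.cast_nonneg (α := ℝ)])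
    linarith [(hr n).1]
  refine ⟨r, fun n => ⟨hhalf n, (hr n).2⟩, ?_, fun n θ h0 => hr' n ?_⟩
  · refine tendsto_nhdsWithin_iff.2 ⟨?_, Eventually.of_forall fun n => (hr n).2⟩
    refine tendsto_of_tendsto_of_tendsto_of_le_of_le ?_ tendsto_const_nhds
      (fun n => (hr n).1.le) (fun n => (hr n).2.le)
    have : Tendsto (fun n : ℕ => 1 / ((n : ℝ) + 2)) atTop (nhds 0) :=
      tendsto_const_nhds.div_atTop
        (tendsto_atTop_add_const_right _ _ tendsto_natCast_atTop_atTop)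
    simpa using this.const_sub 1
  · have hpos : 0 < r n := by linarith [hhalf n]
    exact ⟨_, ⟨h0, mul_circlePt_mem_unitDisk hpos (hr n).2 θ⟩, by
      simp only [norm_mul_circlePt, abs_of_pos hpos]⟩

/-- The integrals of `log ‖f‖` over circles of radius bounded away from `0` are bounded below. -/
lemma exists_le_integral_log_norm {f : ℂ → ℂ} (hf : DifferentiableOn ℂ f unitDisk) :
    ∃ C : ℝ, ∀ r : ℝ, 1 / 2 < r → r < 1 →
      C ≤ ∫ θ in (0 : ℝ)..2 * Real.pi, Real.log ‖f ((r : ℂ) * circlePt θ)‖ := by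
  have hA := hf.analyticOnNhd isOpen_unitDisk
  refine ⟨2 * Real.pi * (((meromorphicOrderAt f 0).untop₀ : ℝ) * Real.log (1 / 2)
    + Real.log ‖meromorphicTrailingCoeffAt f 0‖), fun r h0 h1 => ?_⟩
  have hr : 0 < r := by linarith
  have hsub : Metric.closedBall (0 : ℂ) |r| ⊆ unitDisk := by
    rw [unitDisk_eq_ball, abs_of_pos hr]; exact Metric.closedBall_subset_ball h1
  have hA' : AnalyticOnNhd ℂ f (Metric.closedBall 0 |r|) := hA.mono hsub
  have hJ := MeromorphicOn.circleAverage_log_norm hr.ne' hA'.meromorphicOn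
  have hD := MeromorphicOn.AnalyticOnNhd.divisor_nonneg hA'
  have hsum : 0 ≤ ∑ᶠ u, MeromorphicOn.divisor f (Metric.closedBall 0 |r|) u
      * Real.log (r * ‖(0 : ℂ) - u‖⁻¹) := by
    refine finsum_nonneg fun u => ?_
    by_cases hu : u ∈ Metric.closedBall (0 : ℂ) |r|
    · refine mul_nonneg (by exact_mod_cast hD u) ?_
      rcases eq_or_ne u 0 with rfl | hu0
      · simp
      · refine Real.log_nonneg ?_
        rw [← div_eq_mul_inv, one_le_div (by simpa using hu0)]
        simpa [abs_of_pos hr] using hu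
    · simp [hu]
  have h00 : (0 : ℂ) ∈ Metric.closedBall (0 : ℂ) |r| := by simp
  have hD0 : (0 : ℝ) ≤ ((meromorphicOrderAt f 0).untop₀ : ℝ) := by
    have := hD 0
    rw [MeromorphicOn.divisor_apply hA'.meromorphicOn h00] at this
    exact_mod_cast this
  rw [MeromorphicOn.divisor_apply hA'.meromorphicOn h00, Real.circleAverage_def,
    smul_eq_mul] at hJ
  have hlog : Real.log (1 / 2) ≤ Real.log r := Real.log_le_log (by norm_num) h0.le
  have hint : ∫ θ in (0 : ℝ)..2 * Real.pi, Real.log ‖f ((r : ℂ) * circlePt θ)‖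
      = 2 * Real.pi * ((2 * Real.pi)⁻¹ * ∫ θ in (0 : ℝ)..2 * Real.pi,
        Real.log ‖f (circleMap 0 r θ)‖) := by
    rw [mul_inv_cancel_left₀ (by positivity)]
    simp [circleMap, circlePt]
  rw [hint, hJ]
  have := mul_le_mul_of_nonneg_left hlog hD0
  gcongr
  linarith

/-- Reflection of a bounded analytic function on the exterior disk, multiplied by `z`. -/
def mulReflect (f : ℂ → ℂ) (z : ℂ) : ℂ :=
  z * (starRingEnd ℂ) (f (1 / (starRingEnd ℂ) z))

lemma one_div_conj_mem_extDisk {z : ℂ} (hz : z ∈ unitDisk) (h0 : z ≠ 0) :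
    1 / (starRingEnd ℂ) z ∈ extDisk := by
  have : 0 < ‖z‖ := norm_pos_iff.2 h0
  simpa [extDisk] using (one_lt_inv₀ this).2 hz

lemma norm_mulReflect_le {f : ℂ → ℂ} (hb : ∀ z ∈ extDisk, ‖f z‖ ≤ 1) {z : ℂ}
    (hz : z ∈ unitDisk) : ‖mulReflect f z‖ ≤ ‖z‖ := by
  rcases eq_or_ne z 0 with rfl | h0
  · simp [mulReflect]
  · rw [mulReflect, norm_mul, RCLike.norm_conj]
    exact mul_le_of_le_one_right (norm_nonneg _) (hb _ (one_div_conj_mem_extDisk hz h0))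

lemma differentiableOn_mulReflect {f : ℂ → ℂ} (hf : DifferentiableOn ℂ f extDisk)
    (hb : ∀ z ∈ extDisk, ‖f z‖ ≤ 1) : DifferentiableOn ℂ (mulReflect f) unitDisk := by
  have hmem : unitDisk ∈ nhds (0 : ℂ) := isOpen_unitDisk.mem_nhds (by simp [unitDisk])
  refine (Complex.differentiableOn_compl_singleton_and_continuousAt_iff hmem).1 ⟨?_, ?_⟩
  · rintro z ⟨hz, h0⟩
    have h0 : z ≠ 0 := h0
    have hd : DifferentiableAt ℂ f (1 / (starRingEnd ℂ) z) :=
      hf.differentiableAt (isOpen_extDisk.mem_nhds (one_div_conj_mem_extDisk hz h0))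
    have hcc := hd.conj_conj
    have heq : (starRingEnd ℂ) (1 / (starRingEnd ℂ) z) = z⁻¹ := by simp
    rw [heq] at hcc
    have hcomp := hcc.comp z (differentiableAt_inv h0)
    have h2 : mulReflect f = fun y =>
        y * (((starRingEnd ℂ) ∘ f ∘ (starRingEnd ℂ)) ∘ fun y => y⁻¹) y := by
      ext y; simp [mulReflect]
    rw [h2]
    exact (differentiableAt_id.mul hcomp).differentiableWithinAt
  · have hz : mulReflect f 0 = 0 := by simp [mulReflect]
    rw [ContinuousAt, hz]
    refine squeeze_zero_norm' (a := fun z => ‖z‖) ?_ ?_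
    · filter_upwards [hmem] with z hz using norm_mulReflect_le hb hz
    · simpa using (continuous_norm (E := ℂ)).tendsto 0

/-- If analytic `F` is bounded by `1` on the disk, zero-free on circles of radii `r n`, and
dominated there by quantities tending to `u`, then `log u` is integrable. -/
lemma integrableOn_log_of_tendsto {F : ℂ → ℂ} (hF : DifferentiableOn ℂ F unitDisk)
    (hF1 : ∀ z ∈ unitDisk, ‖F z‖ ≤ 1) {r : ℕ → ℝ} (hr : ∀ n, 1 / 2 < r n ∧ r n < 1)
    (hF0 : ∀ n θ, F ((r n : ℂ) * circlePt θ) ≠ 0) {γ : Set ℝ} (hγ : γ ⊆ Ioc 0 (2 * Real.pi))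
    {u : ℝ → ℝ} (hu : AEStronglyMeasurable u (volume.restrict γ))
    (hu1 : ∀ᵐ θ ∂(volume.restrict γ), 0 ≤ u θ ∧ u θ ≤ 1) {v : ℕ → ℝ → ℝ}
    (hv : ∀ n θ, ‖F ((r n : ℂ) * circlePt θ)‖ ≤ v n θ)
    (hvu : ∀ᵐ θ ∂(volume.restrict γ), Tendsto (fun n => v n θ) atTop (nhds (u θ))) :
    IntegrableOn (fun θ => Real.log (u θ)) γ := by
  have hr0 (n : ℕ) : 0 < r n := by linarith [(hr n).1]
  refine ⟨(Real.measurable_log.comp_aemeasurable hu.aemeasurable).aestronglyMeasurable, ?_⟩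
  obtain ⟨C, hC⟩ := exists_le_integral_log_norm hF
  have hcont (n : ℕ) : Continuous fun θ => -Real.log ‖F ((r n : ℂ) * circlePt θ)‖ :=
    ((continuous_comp_mul_circlePt hF (hr0 n) (hr n).2).norm.log
      fun θ => norm_ne_zero_iff.2 (hF0 n θ)).neg
  have hnonneg (n : ℕ) (θ : ℝ) : 0 ≤ -Real.log ‖F ((r n : ℂ) * circlePt θ)‖ :=
    neg_nonneg.2 (Real.log_nonpos (norm_nonneg _)
      (hF1 _ (mul_circlePt_mem_unitDisk (hr0 n) (hr n).2 θ)))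
  have hbound (n : ℕ) : ∫⁻ θ in γ, ENNReal.ofReal (-Real.log ‖F ((r n : ℂ) * circlePt θ)‖)
      ≤ ENNReal.ofReal (-C) := by
    refine (lintegral_mono_set hγ).trans ?_
    rw [← ofReal_integral_eq_lintegral_ofReal
      ((hcont n).integrableOn_Ioc) (Eventually.of_forall (hnonneg n))]
    refine ENNReal.ofReal_le_ofReal ?_
    rw [← intervalIntegral.integral_of_le (by positivity), intervalIntegral.integral_neg]
    exact neg_le_neg (hC _ (hr n).1 (hr n).2)
  have hpt : ∀ᵐ θ ∂(volume.restrict γ), ‖Real.log (u θ)‖ₑ ≤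
      liminf (fun n => ENNReal.ofReal (-Real.log ‖F ((r n : ℂ) * circlePt θ)‖)) atTop := by
    filter_upwards [hu1, hvu] with θ h1 hlim
    rcases h1.1.eq_or_lt with h0 | h0
    · simp [← h0]
    · have hl : Tendsto (fun n => ENNReal.ofReal (-Real.log (v n θ))) atTop
          (nhds (ENNReal.ofReal (-Real.log (u θ)))) :=
        ENNReal.tendsto_ofReal ((hlim.log h0.ne').neg)
      rw [← ofReal_norm, Real.norm_of_nonpos (Real.log_nonpos h1.1 h1.2), ← hl.liminf_eq]
      refine liminf_le_liminf (Eventually.of_forall fun n => ?_)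
      exact ENNReal.ofReal_le_ofReal (neg_le_neg
        (Real.log_le_log (norm_pos_iff.2 (hF0 n θ)) (hv n θ)))
  calc ∫⁻ θ in γ, ‖Real.log (u θ)‖ₑ
      ≤ ∫⁻ θ in γ, liminf (fun n =>
          ENNReal.ofReal (-Real.log ‖F ((r n : ℂ) * circlePt θ)‖)) atTop := lintegral_mono_ae hpt
    _ ≤ liminf (fun n => ∫⁻ θ in γ,
          ENNReal.ofReal (-Real.log ‖F ((r n : ℂ) * circlePt θ)‖)) atTop :=
        lintegral_liminf_le fun n => (hcont n).measurable.ennreal_ofReal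
    _ ≤ ENNReal.ofReal (-C) :=
        liminf_le_of_le (by isBoundedDefault) fun b hb => by
          obtain ⟨n, hn⟩ := hb.exists
          exact hn.trans (hbound n)
    _ < ⊤ := ENNReal.ofReal_lt_top

/-- Boundary values of the reflection of `st`. -/
lemma RadLimExt.radLim_reflect {st : ℂ → ℂ} {θ : ℝ} {w : ℂ} (h : RadLimExt st θ w) :
    RadLim (fun z => (starRingEnd ℂ) (st (1 / (starRingEnd ℂ) z))) θ ((starRingEnd ℂ) w) := by
  have hinv : Tendsto (fun r : ℝ => r⁻¹) (nhdsWithin 1 (Iio 1)) (nhdsWithin 1 (Ioi 1)) := by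
    refine tendsto_nhdsWithin_iff.2 ⟨?_, ?_⟩
    · simpa using (tendsto_inv₀ (one_ne_zero (α := ℝ))).mono_left nhdsWithin_le_nhds
    · filter_upwards [Ioo_mem_nhdsLT (zero_lt_one (α := ℝ))] with r hr
      exact (one_lt_inv₀ hr.1).2 hr.2
  refine ((Complex.continuous_conj.tendsto w).comp (Filter.Tendsto.comp h hinv)).congr fun r => ?_
  have hc : (starRingEnd ℂ) (circlePt θ) = (circlePt θ)⁻¹ := by
    simp [circlePt, ← Complex.exp_conj, ← Complex.exp_neg]
  simp [hc, mul_comm]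

/-- Boundary values of `1 - g s`, where `g` is the reflection of a pseudocontinuation of `s`. -/
lemma RadLim.radLim_one_sub {s st : ℂ → ℂ} {θ : ℝ} {w : ℂ} (h : RadLim s θ w)
    (h' : RadLimExt st θ w) :
    RadLim (fun z => 1 - (starRingEnd ℂ) (st (1 / (starRingEnd ℂ) z)) * s z) θ
      ((1 - ‖w‖ ^ 2 : ℝ) : ℂ) := by
  have : ((1 - ‖w‖ ^ 2 : ℝ) : ℂ) = 1 - (starRingEnd ℂ) w * w := by
    rw [Complex.conj_mul']; push_cast; rfl
  rw [this]
  exact (Filter.Tendsto.mul h'.radLim_reflect h).const_sub 1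

lemma RadLim.eq {f : ℂ → ℂ} {θ : ℝ} {w w' : ℂ} (h : RadLim f θ w) (h' : RadLim f θ w') :
    w = w' := tendsto_nhds_unique h h'

lemma SchurFn.norm_le_of_radLim {s : ℂ → ℂ} (hs : SchurFn s) {θ : ℝ} {w : ℂ}
    (h : RadLim s θ w) : ‖w‖ ≤ 1 := by
  refine le_of_tendsto (Filter.Tendsto.norm h) ?_
  filter_upwards [Ioo_mem_nhdsLT (zero_lt_one (α := ℝ))] with r hr
  exact hs.2 _ (mul_circlePt_mem_unitDisk hr.1 hr.2 θ)

/-- if `s` is Schur with pseudocontinuation `st` of bounded type across the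
arc `γ` and `s` is not unimodular a.e. on `γ`, then `h = 1 - g·s` with
`g z = conj (st (1/conj z))` is a not-identically-zero Nevanlinna function on the disk,
and consequently `∫_γ log(1-|s|²) dm > -∞`. -/
theorem statement0 (s st : ℂ → ℂ) (γ : Set ℝ) (hγ : IsArc γ)
    (hs : SchurFn s) (hst : NevOn extDisk st)
    (hagree : ∀ᵐ θ ∂(volume.restrict γ), ∃ w : ℂ, RadLim s θ w ∧ RadLimExt st θ w)
    (hnotuni : ¬ UnimodularAEOn s γ) :
    NevOn unitDisk (fun z => 1 - (starRingEnd ℂ) (st (1 / (starRingEnd ℂ) z)) * s z) ∧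
    (∃ z ∈ unitDisk, 1 - (starRingEnd ℂ) (st (1 / (starRingEnd ℂ) z)) * s z ≠ 0) ∧
    ∀ sb : ℝ → ℂ, (∀ᵐ θ ∂(volume.restrict γ), RadLim s θ (sb θ)) →
      IntegrableOn (fun θ => Real.log (1 - ‖sb θ‖ ^ 2)) γ := by
  obtain ⟨a, b, ha, hab, hb, rfl⟩ := hγ
  obtain ⟨f₁, f₂, hf₁, hf₂, hb₁, hb₂, ⟨z₀, hz₀, hfz₀⟩, hq⟩ := hst
  set h : ℂ → ℂ := fun z => 1 - (starRingEnd ℂ) (st (1 / (starRingEnd ℂ) z)) * s z with hh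
  set A := mulReflect f₁ with hA
  set B := mulReflect f₂ with hB
  have hAd : DifferentiableOn ℂ A unitDisk := differentiableOn_mulReflect hf₁ hb₁
  have hBd : DifferentiableOn ℂ B unitDisk := differentiableOn_mulReflect hf₂ hb₂
  have hA1 : ∀ z ∈ unitDisk, ‖A z‖ ≤ 1 := fun z hz => (norm_mulReflect_le hb₁ hz).trans hz.le
  have hB1 : ∀ z ∈ unitDisk, ‖B z‖ ≤ 1 := fun z hz => (norm_mulReflect_le hb₂ hz).trans hz.le
  have hBne : ∃ z ∈ unitDisk, B z ≠ 0 := by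
    have hpos : 0 < ‖z₀‖ := one_pos.trans hz₀
    refine ⟨1 / (starRingEnd ℂ) z₀, ?_, ?_⟩
    · simpa [unitDisk] using (inv_lt_one₀ hpos).2 hz₀
    · have : z₀ ≠ 0 := norm_pos_iff.1 hpos
      simp [hB, mulReflect, this, hfz₀]
  set F₁ : ℂ → ℂ := fun z => (B z - A z * s z) / 2 with hF₁
  set F₂ : ℂ → ℂ := fun z => B z / 2 with hF₂
  have hF₁d : DifferentiableOn ℂ F₁ unitDisk := (hBd.sub (hAd.mul hs.1)).div_const 2
  have hF₂d : DifferentiableOn ℂ F₂ unitDisk := hBd.div_const 2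
  have hF₁1 : ∀ z ∈ unitDisk, ‖F₁ z‖ ≤ 1 := fun z hz => by
    have h1 : ‖A z * s z‖ ≤ 1 := by
      rw [norm_mul]; exact mul_le_one₀ (hA1 z hz) (norm_nonneg _) (hs.2 z hz)
    have h2 := norm_sub_le (B z) (A z * s z)
    have h3 : ‖F₁ z‖ = ‖B z - A z * s z‖ / 2 := by simp [hF₁]
    linarith [hB1 z hz]
  have hF₂1 : ∀ z ∈ unitDisk, ‖F₂ z‖ ≤ 1 := fun z hz => by
    have h3 : ‖F₂ z‖ = ‖B z‖ / 2 := by simp [hF₂]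
    linarith [hB1 z hz, norm_nonneg (B z)]
  have hF₂ne : ∃ z ∈ unitDisk, F₂ z ≠ 0 := by
    obtain ⟨z, hz, hBz⟩ := hBne
    exact ⟨z, hz, div_ne_zero hBz two_ne_zero⟩
  have hquot : ∀ z ∈ unitDisk, F₂ z ≠ 0 → h z = F₁ z / F₂ z := fun z hz hne => by
    have hBz : B z ≠ 0 := fun h0 => hne (by simp [hF₂, h0])
    have hz0 : z ≠ 0 := by
      rintro rfl; exact hBz (by simp [hB, mulReflect])
    have hc : (starRingEnd ℂ) (f₂ (1 / (starRingEnd ℂ) z)) ≠ 0 := by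
      intro h0; exact hBz (by rw [hB, mulReflect, h0, mul_zero])
    have hf : f₂ (1 / (starRingEnd ℂ) z) ≠ 0 := by
      intro h0; exact hc (by rw [h0, map_zero])
    have hst' := hq _ (one_div_conj_mem_extDisk hz hz0) hf
    simp only [hh, hF₁, hF₂, hA, hB, mulReflect]
    rw [hst', map_div₀]
    field_simp
  have hF₁ne : ∃ z ∈ unitDisk, F₁ z ≠ 0 := by
    by_contra! hcon
    obtain ⟨r, hr, hrt, hr0⟩ := exists_seq_radii_ne_zero hF₂d hF₂ne
    refine hnotuni ?_
    filter_upwards [hagree] with θ ⟨w, hw, hw'⟩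
    refine ⟨w, hw, ?_⟩
    have hlim := Filter.Tendsto.comp (hw.radLim_one_sub hw') hrt
    have hzero (n : ℕ) : h ((r n : ℂ) * circlePt θ) = 0 := by
      have hmem := mul_circlePt_mem_unitDisk (by linarith [(hr n).1]) (hr n).2 θ
      rw [hquot _ hmem (hr0 n θ), hcon _ hmem, zero_div]
    have h0 : ((1 - ‖w‖ ^ 2 : ℝ) : ℂ) = 0 :=
      tendsto_nhds_unique hlim (tendsto_const_nhds.congr fun n => (hzero n).symm)
    have h1 : ‖w‖ ^ 2 = 1 := by linarith [Complex.ofReal_eq_zero.1 h0]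
    exact (pow_eq_one_iff_of_nonneg (norm_nonneg w) two_ne_zero).1 h1
  have hFne : ∃ z ∈ unitDisk, (F₁ z * F₂ z) ≠ 0 := by
    by_contra! hcon
    rcases AnalyticOnNhd.eq_zero_or_eq_zero_of_mul_eq_zero (hF₁d.analyticOnNhd isOpen_unitDisk)
      (hF₂d.analyticOnNhd isOpen_unitDisk) hcon isConnected_unitDisk.isPreconnected with h1 | h1
    · obtain ⟨z, hz, hne⟩ := hF₁ne
      exact hne (h1 z hz)
    · obtain ⟨z, hz, hne⟩ := hF₂ne
      exact hne (h1 z hz)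
  refine ⟨⟨F₁, F₂, hF₁d, hF₂d, hF₁1, hF₂1, hF₂ne, hquot⟩, ?_, fun sb hsb => ?_⟩
  · obtain ⟨z, hz, hne⟩ := hFne
    have := mul_ne_zero_iff.1 hne
    refine ⟨z, hz, ?_⟩
    change h z ≠ 0
    rw [hquot z hz this.2]
    exact div_ne_zero this.1 this.2
  · obtain ⟨r, hr, hrt, hr0⟩ := exists_seq_radii_ne_zero (hF₁d.mul hF₂d) hFne
    have hpos (n : ℕ) : 0 < r n := by linarith [(hr n).1]
    have hsbm : AEStronglyMeasurable sb (volume.restrict (Ioo a b)) := by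
      refine aestronglyMeasurable_of_tendsto_ae atTop
        (f := fun n θ => s ((r n : ℂ) * circlePt θ))
        (fun n => (continuous_comp_mul_circlePt hs.1 (hpos n) (hr n).2).aestronglyMeasurable) ?_
      filter_upwards [hsb] with θ hθ
      unfold RadLim at hθ
      exact hθ.comp hrt
    refine integrableOn_log_of_tendsto hF₁d hF₁1 hr
      (fun n θ => (mul_ne_zero_iff.1 (hr0 n θ)).1)
      (fun θ hθ => ⟨ha.trans_lt hθ.1, hθ.2.le.trans hb⟩)
      (aestronglyMeasurable_const.sub (hsbm.norm.pow 2)) ?_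
      (v := fun n θ => ‖h ((r n : ℂ) * circlePt θ)‖) (fun n θ => ?_) ?_
    · filter_upwards [hsb] with θ hθ
      have h1 := hs.norm_le_of_radLim hθ
      have h2 : ‖sb θ‖ ^ 2 ≤ 1 := pow_le_one₀ (norm_nonneg _) h1
      exact ⟨by linarith, by linarith [sq_nonneg ‖sb θ‖]⟩
    · have hmem := mul_circlePt_mem_unitDisk (hpos n) (hr n).2 θ
      have hne := (mul_ne_zero_iff.1 (hr0 n θ)).2
      change ‖F₁ _‖ ≤ ‖h _‖
      rw [hquot _ hmem hne, norm_div (F₁ _)]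
      exact le_div_self (norm_nonneg _) (norm_pos_iff.2 hne) (hF₂1 _ hmem)
    · filter_upwards [hsb, hagree] with θ hθ ⟨w, hw, hw'⟩
      obtain rfl := hθ.eq hw
      have h2 : ‖sb θ‖ ^ 2 ≤ 1 := pow_le_one₀ (norm_nonneg _) (hs.norm_le_of_radLim hθ)
      have hlim := (Filter.Tendsto.comp (hw.radLim_one_sub hw') hrt).norm
      rwa [Complex.norm_real, Real.norm_of_nonneg (by linarith)] at hlim
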